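/- Fix k ∈ ℝ \ {0} and q₀ ∈ L²((0,1),ℝ) with ψ(k,q₀) ≠ 0. Then the map q ↦ S(k,q) = ψ(−k,q)/ψ(k,q), defined for q in a neighborhood of q₀ in L²((0,1),ℝ), is Fréchet differentiable at q₀, and its Fréchet derivative at q₀ is the bounded linear map h ↦ −2ik·∫₀¹ ( φ(x,k,q₀)² / ψ(k,q₀)² )·h(x) dx. -/

import Mathlib

open MeasureTheory Set

noncomputable section

/-- `y` solves `-y'' + q y = E y` on `[0,∞)`: `y` is continuously differentiable with
derivative `y'`, `y'` is absolutely continuous (an indefinite integral of a locally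
integrable `y''`), and the equation holds for a.e. `x ≥ 0`. -/
def SchrodingerSol (q : ℝ → ℂ) (E : ℂ) (y y' : ℝ → ℂ) : Prop :=
  (∀ x : ℝ, 0 ≤ x → HasDerivAt y (y' x) x) ∧
  ∃ y'' : ℝ → ℂ,
    (∀ X : ℝ, IntegrableOn y'' (Icc 0 X)) ∧
    (∀ x : ℝ, 0 ≤ x → y' x = y' 0 + ∫ t in (0:ℝ)..x, y'' t) ∧
    (∀ᵐ x : ℝ, 0 ≤ x → -y'' x + q x * y x = E * y x)

/-- The Jost solution `f₊(·,k)` (with derivative `f'`): it solves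
`-y'' + q y = k² y` and equals `e^{ikx}` for `x ≥ 1`. -/
def IsJost (q : ℝ → ℂ) (k : ℂ) (f f' : ℝ → ℂ) : Prop :=
  SchrodingerSol q (k ^ 2) f f' ∧
  ∀ x : ℝ, 1 ≤ x → f x = Complex.exp (Complex.I * k * (x : ℂ))

/-- The fundamental solution `φ(·,k)` (with derivative `y'`): it solves
`-y'' + q y = k² y` with `y(0) = 0`, `y'(0) = 1`. -/
def IsPhi (q : ℝ → ℂ) (k : ℂ) (y y' : ℝ → ℂ) : Prop :=
  SchrodingerSol q (k ^ 2) y y' ∧ y 0 = 0 ∧ y' 0 = 1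

/-- A potential in `L²((0,1),ℝ)` extended by zero to the whole line (as a
complex-valued function). -/
def extQ (q : Lp ℝ 2 (volume.restrict (Ioo (0:ℝ) 1))) : ℝ → ℂ :=
  fun x => ((((Ioo (0:ℝ) 1).indicator (q : ℝ → ℝ) x) : ℝ) : ℂ)


open Filter Topology

theorem AbsolutelyContinuousOnInterval.of_dist_le {X Y : Type*} [PseudoMetricSpace X]
    [PseudoMetricSpace Y] {f : ℝ → X} {g : ℝ → Y} {a b : ℝ}
    (hg : AbsolutelyContinuousOnInterval g a b)
    (h : ∀ x ∈ uIcc a b, ∀ y ∈ uIcc a b, dist (f x) (f y) ≤ dist (g x) (g y)) :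
    AbsolutelyContinuousOnInterval f a b := by
  rw [absolutelyContinuousOnInterval_iff] at hg ⊢
  intro ε hε
  obtain ⟨δ, hδ, H⟩ := hg ε hε
  refine ⟨δ, hδ, fun E hE hlt => (Finset.sum_le_sum fun i hi => ?_).trans_lt (H E hE hlt)⟩
  exact h _ (hE.1 i hi).1 _ (hE.1 i hi).2

theorem absolutelyContinuousOnInterval_integral {f : ℝ → ℂ} {a b c : ℝ}
    (hf : IntervalIntegrable f volume a b) (hc : c ∈ uIcc a b) :
    AbsolutelyContinuousOnInterval (fun x => ∫ t in c..x, f t) a b := by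
  refine (hf.norm.absolutelyContinuousOnInterval_intervalIntegral hc).of_dist_le
    fun x hx y hy => ?_
  have hcx : IntervalIntegrable f volume c x := hf.mono_set (uIcc_subset_uIcc hc hx)
  have hcy : IntervalIntegrable f volume c y := hf.mono_set (uIcc_subset_uIcc hc hy)
  rw [dist_eq_norm, dist_eq_norm, intervalIntegral.integral_interval_sub_left hcx hcy,
    intervalIntegral.integral_interval_sub_left hcx.norm hcy.norm]
  exact intervalIntegral.norm_integral_le_abs_integral_norm

/-- Integration by parts for two complex-valued indefinite integrals. -/
theorem mul_indefinite_integral_eq {f g : ℝ → ℂ} {a b : ℝ} (c d : ℂ)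
    (hf : IntervalIntegrable f volume a b) (hg : IntervalIntegrable g volume a b) :
    (c + ∫ t in a..b, f t) * (d + ∫ t in a..b, g t) = c * d +
      ∫ x in a..b, (f x * (d + ∫ t in a..x, g t) + (c + ∫ t in a..x, f t) * g x) := by
  have hF := absolutelyContinuousOnInterval_integral hf left_mem_uIcc
  have hG := absolutelyContinuousOnInterval_integral hg left_mem_uIcc
  have hconst : ∀ z : ℂ, AbsolutelyContinuousOnInterval (fun _ => z) a b := fun z =>
    hF.of_dist_le fun x _ y _ => by simp
  have hF' := (hconst c).fun_add hF
  have hG' := (hconst d).fun_add hG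
  have hint : IntervalIntegrable (fun x => f x * (d + ∫ t in a..x, g t)
      + (c + ∫ t in a..x, f t) * g x) volume a b :=
    (hf.mul_continuousOn hG'.continuousOn).add (hg.continuousOn_mul hF'.continuousOn)
  obtain ⟨C, hC⟩ := ((hF'.fun_smul hG').fun_sub
    (absolutelyContinuousOnInterval_integral hint left_mem_uIcc)).const_of_ae_hasDerivAt_zero (by
      filter_upwards [hf.ae_hasDerivAt_integral, hg.ae_hasDerivAt_integral,
        hint.ae_hasDerivAt_integral] with x h1 h2 h3 hx
      have := (((h1 hx a left_mem_uIcc).const_add c).mul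
        ((h2 hx a left_mem_uIcc).const_add d)).sub (h3 hx a left_mem_uIcc)
      simpa using! this)
  have ha := hC a left_mem_uIcc
  have hb := hC b right_mem_uIcc
  simp only [intervalIntegral.integral_same, smul_eq_mul, add_zero, sub_zero] at ha hb
  rw [← ha] at hb
  linear_combination hb

namespace SchrodingerSol

variable {q q₁ q₂ : ℝ → ℂ} {E : ℂ} {u u' v v' : ℝ → ℂ}

theorem continuousOn (h : SchrodingerSol q E u u') (a b : ℝ) (ha : 0 ≤ a) :
    ContinuousOn u (Icc a b) := fun x hx =>
  (h.1 x (ha.trans hx.1)).continuousAt.continuousWithinAt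

/-- The Lagrange identity for the Wronskian of two solutions with the same energy. -/
theorem wronskian (hu : SchrodingerSol q₁ E u u') (hv : SchrodingerSol q₂ E v v')
    {b : ℝ} (hb : 0 ≤ b) :
    IntervalIntegrable (fun x => u x * v x * (q₂ x - q₁ x)) volume 0 b ∧
    u b * v' b - u' b * v b = u 0 * v' 0 - u' 0 * v 0
      + ∫ x in (0:ℝ)..b, u x * v x * (q₂ x - q₁ x) := by
  have key : ∀ {q : ℝ → ℂ} {y y' : ℝ → ℂ}, SchrodingerSol q E y y' → ∃ y'' : ℝ → ℂ,
      IntervalIntegrable y'' volume 0 b ∧ IntervalIntegrable y' volume 0 b ∧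
      ContinuousOn y' (uIcc 0 b) ∧
      (∀ x ∈ Icc 0 b, y' x = y' 0 + ∫ t in (0:ℝ)..x, y'' t) ∧
      (∀ x ∈ Icc 0 b, y x = y 0 + ∫ t in (0:ℝ)..x, y' t) ∧
      (∀ᵐ x : ℝ, 0 ≤ x → y'' x = (q x - E) * y x) := by
    rintro q y y' ⟨hd, y'', hi, hy', he⟩
    have hi' : IntervalIntegrable y'' volume 0 b :=
      (intervalIntegrable_iff_integrableOn_Icc_of_le hb).2 (hi b)
    have hc : ContinuousOn y' (Icc 0 b) := by
      have := (absolutelyContinuousOnInterval_integral hi' left_mem_uIcc).continuousOn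
      rw [uIcc_of_le hb] at this
      exact (continuousOn_const.add this).congr fun x hx => hy' x hx.1
    have hI : IntervalIntegrable y' volume 0 b := by
      apply ContinuousOn.intervalIntegrable
      rwa [uIcc_of_le hb]
    refine ⟨y'', hi', hI, by rwa [uIcc_of_le hb], fun x hx => hy' x hx.1, fun x hx => ?_, ?_⟩
    · rw [intervalIntegral.integral_eq_sub_of_hasDerivAt (f := y)]
      · ring
      · intro t ht
        rw [uIcc_of_le hx.1] at ht
        exact hd t ht.1
      · apply hI.mono_set
        rw [uIcc_of_le hx.1, uIcc_of_le hb]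
        exact Icc_subset_Icc_right hx.2
    · filter_upwards [he] with x hx h0
      linear_combination -hx h0
  obtain ⟨u'', hu2, hu1, hcu', eu1, eu, hue⟩ := key hu
  obtain ⟨v'', hv2, hv1, hcv', ev1, ev, hve⟩ := key hv
  have hcu : ContinuousOn u (uIcc 0 b) := by rw [uIcc_of_le hb]; exact hu.continuousOn _ _ le_rfl
  have hcv : ContinuousOn v (uIcc 0 b) := by rw [uIcc_of_le hb]; exact hv.continuousOn _ _ le_rfl
  have hbb : b ∈ Icc 0 b := right_mem_Icc.2 hb
  have h1 := mul_indefinite_integral_eq (u 0) (v' 0) hu1 hv2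
  have h2 := mul_indefinite_integral_eq (u' 0) (v 0) hu2 hv1
  have c1 : ∫ x in (0:ℝ)..b, (u' x * (v' 0 + ∫ t in (0:ℝ)..x, v'' t)
      + (u 0 + ∫ t in (0:ℝ)..x, u' t) * v'' x) = ∫ x in (0:ℝ)..b, (u' x * v' x + u x * v'' x) :=
    intervalIntegral.integral_congr fun x hx => by
      rw [uIcc_of_le hb] at hx
      simp only [← eu x hx, ← ev1 x hx]
  have c2 : ∫ x in (0:ℝ)..b, (u'' x * (v 0 + ∫ t in (0:ℝ)..x, v' t)
      + (u' 0 + ∫ t in (0:ℝ)..x, u'' t) * v' x) = ∫ x in (0:ℝ)..b, (u'' x * v x + u' x * v' x) :=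
    intervalIntegral.integral_congr fun x hx => by
      rw [uIcc_of_le hb] at hx
      simp only [← eu1 x hx, ← ev x hx]
  rw [c1, ← eu b hbb, ← ev1 b hbb] at h1
  rw [c2, ← eu1 b hbb, ← ev b hbb] at h2
  have i1 : IntervalIntegrable (fun x => u' x * v' x + u x * v'' x) volume 0 b :=
    (hu1.mul_continuousOn hcv').add (hv2.continuousOn_mul hcu)
  have i2 : IntervalIntegrable (fun x => u'' x * v x + u' x * v' x) volume 0 b :=
    (hu2.mul_continuousOn hcv).add (hv1.continuousOn_mul hcu')
  have hae : ∀ᵐ x, x ∈ uIoc 0 b → (u' x * v' x + u x * v'' x) - (u'' x * v x + u' x * v' x)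
      = u x * v x * (q₂ x - q₁ x) := by
    filter_upwards [hue, hve] with x h1 h2 hx
    rw [uIoc_of_le hb] at hx
    rw [h1 hx.1.le, h2 hx.1.le]
    ring
  refine ⟨(i1.sub i2).congr_ae ((ae_restrict_iff' measurableSet_uIoc).2 hae), ?_⟩
  rw [← intervalIntegral.integral_congr_ae hae, intervalIntegral.integral_sub i1 i2, h1, h2]
  ring

end SchrodingerSol

/-- The space `L²((0,1),ℝ)` of potentials. -/
abbrev L2Unit : Type := Lp ℝ 2 (volume.restrict (Ioo (0:ℝ) 1))

theorem extQ_ae_eq (h : L2Unit) : ∀ᵐ x : ℝ, x ∈ uIoc 0 1 → extQ h x = ((h : ℝ → ℝ) x : ℂ) := by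
  filter_upwards [Measure.ae_ne volume (1 : ℝ)] with x hx hx'
  rw [uIoc_of_le zero_le_one] at hx'
  simp [extQ, indicator_of_mem (show x ∈ Ioo (0:ℝ) 1 from ⟨hx'.1, hx'.2.lt_of_ne hx⟩)]

theorem extQ_add (g h : L2Unit) : ∀ᵐ x : ℝ, extQ (g + h) x = extQ g x + extQ h x := by
  filter_upwards [(ae_restrict_iff' measurableSet_Ioo).1 (Lp.coeFn_add g h)] with x hx
  by_cases hm : x ∈ Ioo (0:ℝ) 1
  · simp only [extQ, indicator_of_mem hm, hx hm, Pi.add_apply, Complex.ofReal_add]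
  · simp [extQ, hm]

theorem extQ_sub (g h : L2Unit) : ∀ᵐ x : ℝ, extQ (g - h) x = extQ g x - extQ h x := by
  filter_upwards [(ae_restrict_iff' measurableSet_Ioo).1 (Lp.coeFn_sub g h)] with x hx
  by_cases hm : x ∈ Ioo (0:ℝ) 1
  · simp only [extQ, indicator_of_mem hm, hx hm, Pi.sub_apply, Complex.ofReal_sub]
  · simp [extQ, hm]

theorem extQ_smul (c : ℝ) (h : L2Unit) : ∀ᵐ x : ℝ, extQ (c • h) x = c * extQ h x := by
  filter_upwards [(ae_restrict_iff' measurableSet_Ioo).1 (Lp.coeFn_smul c h)] with x hx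
  by_cases hm : x ∈ Ioo (0:ℝ) 1
  · simp [extQ, hm, hx hm]
  · simp [extQ, hm]

instance isProbabilityMeasure_restrict_Ioo :
    IsProbabilityMeasure (volume.restrict (Ioo (0:ℝ) 1)) := ⟨by simp⟩

theorem integrable_coeFn (h : L2Unit) :
    Integrable (h : ℝ → ℝ) (volume.restrict (Ioo (0:ℝ) 1)) :=
  (Lp.memLp h).integrable (by norm_num)

theorem intervalIntegrable_extQ (h : L2Unit) : IntervalIntegrable (extQ h) volume 0 1 := by
  rw [intervalIntegrable_iff_integrableOn_Ioo_of_le zero_le_one]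
  refine (integrable_coeFn h).ofReal.congr ?_
  filter_upwards [ae_restrict_mem measurableSet_Ioo] with x hx
  simp [extQ, hx]

theorem integral_norm_extQ_le (h : L2Unit) : ∫ x in (0:ℝ)..1, ‖extQ h x‖ ≤ ‖h‖ := by
  have e : ∫ x in (0:ℝ)..1, ‖extQ h x‖ = ∫ x in Ioo (0:ℝ) 1, ‖(h : ℝ → ℝ) x‖ := by
    rw [intervalIntegral.integral_of_le zero_le_one, integral_Ioc_eq_integral_Ioo]
    refine setIntegral_congr_fun measurableSet_Ioo fun x hx => ?_
    simp [extQ, hx]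
  rw [e, integral_norm_eq_lintegral_enorm (integrable_coeFn h).1, ← eLpNorm_one_eq_lintegral_enorm,
    Lp.norm_def]
  exact ENNReal.toReal_mono (Lp.eLpNorm_ne_top h)
    (eLpNorm_le_eLpNorm_of_exponent_le (by norm_num) (Lp.aestronglyMeasurable h))

theorem norm_integral_mul_extQ_le {g : ℝ → ℂ} {C : ℝ} (hC : ∀ x ∈ Icc (0:ℝ) 1, ‖g x‖ ≤ C)
    {a : ℝ} (ha : a ∈ Icc (0:ℝ) 1) (h : L2Unit) :
    ‖∫ x in a..1, g x * extQ h x‖ ≤ C * ‖h‖ := by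
  have hC0 : 0 ≤ C := (norm_nonneg _).trans (hC a ha)
  have hi := (intervalIntegrable_extQ h).norm
  have hia : IntervalIntegrable (fun x => ‖extQ h x‖) volume a 1 := hi.mono_set (by
    rw [uIcc_of_le ha.2, uIcc_of_le zero_le_one]; exact Icc_subset_Icc_left ha.1)
  calc ‖∫ x in a..1, g x * extQ h x‖ ≤ ∫ x in a..1, C * ‖extQ h x‖ := by
        refine intervalIntegral.norm_integral_le_of_norm_le ha.2
          (Eventually.of_forall fun x hx => ?_) (hia.const_mul C)
        rw [norm_mul]
        gcongr
        exact hC x ⟨ha.1.trans hx.1.le, hx.2⟩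
    _ = C * ∫ x in a..1, ‖extQ h x‖ := intervalIntegral.integral_const_mul _ _
    _ ≤ C * ∫ x in (0:ℝ)..1, ‖extQ h x‖ := by
        gcongr
        exact intervalIntegral.integral_mono_interval ha.1 ha.2 le_rfl
          (Eventually.of_forall fun x => norm_nonneg _) hi
    _ ≤ C * ‖h‖ := by gcongr; exact integral_norm_extQ_le h

theorem intervalIntegrable_mul_extQ {g : ℝ → ℂ} (hg : ContinuousOn g (Icc 0 1)) (h : L2Unit) :
    IntervalIntegrable (fun x => g x * extQ h x) volume 0 1 :=
  (intervalIntegrable_extQ h).continuousOn_mul (by rwa [uIcc_of_le zero_le_one])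

/-- Integration against a continuous function is a bounded functional of the potential. -/
theorem exists_clm_integral_mul_extQ {g : ℝ → ℂ} (hg : ContinuousOn g (Icc 0 1)) :
    ∃ L : L2Unit →L[ℝ] ℂ, ∀ h, L h = ∫ x in (0:ℝ)..1, g x * extQ h x := by
  obtain ⟨C, hC⟩ := isCompact_Icc.exists_bound_of_continuousOn hg
  refine ⟨LinearMap.mkContinuous
    { toFun := fun h => ∫ x in (0:ℝ)..1, g x * extQ h x
      map_add' := fun h₁ h₂ => ?_
      map_smul' := fun c h => ?_ } C fun h =>
        norm_integral_mul_extQ_le hC (left_mem_Icc.2 zero_le_one) h, fun h => rfl⟩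
  · rw [← intervalIntegral.integral_add (intervalIntegrable_mul_extQ hg h₁)
      (intervalIntegrable_mul_extQ hg h₂)]
    refine intervalIntegral.integral_congr_ae ?_
    filter_upwards [extQ_add h₁ h₂] with x hx _
    rw [hx, mul_add]
  · rw [RingHom.id_apply, Complex.real_smul, ← intervalIntegral.integral_const_mul]
    refine intervalIntegral.integral_congr_ae ?_
    filter_upwards [extQ_smul c h] with x hx _
    rw [hx]
    ring

/-- The change of the Wronskian over `[x,1]` is linear in the difference of the potentials. -/
theorem wronskian_sub_wronskian_one {q₁ q₂ : L2Unit} {E : ℂ} {u u' v v' : ℝ → ℂ}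
    (hu : SchrodingerSol (extQ q₁) E u u') (hv : SchrodingerSol (extQ q₂) E v v')
    {x : ℝ} (hx : x ∈ Icc (0:ℝ) 1) :
    (u x * v' x - u' x * v x) - (u 1 * v' 1 - u' 1 * v 1)
      = ∫ t in x..1, u t * v t * extQ (q₁ - q₂) t := by
  obtain ⟨i1, e1⟩ := hu.wronskian hv zero_le_one
  obtain ⟨ix, ex⟩ := hu.wronskian hv hx.1
  have e : ∫ t in x..1, u t * v t * extQ (q₁ - q₂) t
      = ∫ t in x..1, -(u t * v t * (extQ q₂ t - extQ q₁ t)) := by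
    refine intervalIntegral.integral_congr_ae ?_
    filter_upwards [extQ_sub q₁ q₂] with t ht _
    rw [ht]
    ring
  rw [e, intervalIntegral.integral_neg, ← intervalIntegral.integral_interval_sub_left i1 ix, e1, ex]
  ring

theorem wronskian_eq_wronskian_one {q : L2Unit} {E : ℂ} {u u' v v' : ℝ → ℂ}
    (hu : SchrodingerSol (extQ q) E u u') (hv : SchrodingerSol (extQ q) E v v')
    {x : ℝ} (hx : x ∈ Icc (0:ℝ) 1) :
    u x * v' x - u' x * v x = u 1 * v' 1 - u' 1 * v 1 := by
  have h := wronskian_sub_wronskian_one hu hv hx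
  have hz : ∀ᵐ t : ℝ, t ∈ uIoc x 1 → u t * v t * extQ (q - q) t = 0 := by
    filter_upwards [extQ_sub q q] with t ht _
    rw [ht, sub_self, mul_zero]
  rw [intervalIntegral.integral_congr_ae hz, intervalIntegral.integral_zero] at h
  exact sub_eq_zero.1 h

namespace IsJost

variable {q : ℝ → ℂ} {k : ℂ} {f f' : ℝ → ℂ}

theorem apply_one (h : IsJost q k f f') : f 1 = Complex.exp (Complex.I * k) := by
  simpa using h.2 1 le_rfl

theorem deriv_one (h : IsJost q k f f') : f' 1 = Complex.I * k * Complex.exp (Complex.I * k) := by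
  have h1 : HasDerivWithinAt f (f' 1) (Ici 1) 1 := (h.1.1 1 zero_le_one).hasDerivWithinAt
  have h2 : HasDerivAt (fun x : ℝ => Complex.exp (Complex.I * k * (x : ℂ)))
      (Complex.I * k * Complex.exp (Complex.I * k)) 1 := by
    have := ((Complex.ofRealCLM.hasDerivAt (x := (1:ℝ))).const_mul (Complex.I * k)).cexp
    simpa [mul_comm] using this
  have h3 : HasDerivWithinAt f (Complex.I * k * Complex.exp (Complex.I * k)) (Ici 1) 1 :=
    h2.hasDerivWithinAt.congr (fun x hx => h.2 x hx) (h.2 1 le_rfl)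
  exact (uniqueDiffOn_Ici (1:ℝ) 1 self_mem_Ici).eq_deriv _ h1 h3

/-- The Wronskian of the two Jost solutions with opposite momenta. -/
theorem wronskian_neg {q : L2Unit} {fp fp' fm fm' : ℝ → ℂ} (hp : IsJost (extQ q) k fp fp')
    (hm : IsJost (extQ q) (-k) fm fm') {x : ℝ} (hx : x ∈ Icc (0:ℝ) 1) :
    fp x * fm' x - fp' x * fm x = -(2 * Complex.I * k) := by
  have hm1 := hm.1
  rw [neg_sq] at hm1
  rw [wronskian_eq_wronskian_one hp.1 hm1 hx, hp.apply_one, hp.deriv_one, hm.apply_one,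
    hm.deriv_one]
  have : Complex.exp (Complex.I * k) * Complex.exp (Complex.I * -k) = 1 := by
    rw [← Complex.exp_add]; simp
  linear_combination -(2 * Complex.I * k) * this

end IsJost

/-- Local Lipschitz dependence of the Jost solution on the potential, relative to a bound on the
perturbed solution. -/
theorem norm_jost_sub_le {k : ℝ} (hk : k ≠ 0) {κ : ℂ} (hκ : κ ^ 2 = (k : ℂ) ^ 2) {q q₀ : L2Unit}
    {fp fp' fm fm' f f' g g' : ℝ → ℂ} (hp : IsJost (extQ q₀) k fp fp')
    (hm : IsJost (extQ q₀) (-(k : ℂ)) fm fm') (hf : IsJost (extQ q) κ f f')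
    (hg : IsJost (extQ q₀) κ g g') {M N : ℝ} (hMp : ∀ x ∈ Icc (0:ℝ) 1, ‖fp x‖ ≤ M)
    (hMm : ∀ x ∈ Icc (0:ℝ) 1, ‖fm x‖ ≤ M) (hN : ∀ x ∈ Icc (0:ℝ) 1, ‖f x‖ ≤ N)
    {x : ℝ} (hx : x ∈ Icc (0:ℝ) 1) :
    ‖f x - g x‖ ≤ M ^ 2 / |k| * N * ‖q - q₀‖ := by
  have hM0 : 0 ≤ M := (norm_nonneg _).trans (hMp x hx)
  have hN0 : 0 ≤ N := (norm_nonneg _).trans (hN x hx)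
  have hfs := hf.1
  have hgs := hg.1
  have hms := hm.1
  rw [hκ] at hfs hgs
  rw [neg_sq] at hms
  have h1 : f 1 = g 1 := hf.apply_one.trans hg.apply_one.symm
  have h1' : f' 1 = g' 1 := hf.deriv_one.trans hg.deriv_one.symm
  have bound : ∀ {v v' : ℝ → ℂ}, SchrodingerSol (extQ q₀) ((k : ℂ) ^ 2) v v' →
      (∀ t ∈ Icc (0:ℝ) 1, ‖v t‖ ≤ M) →
      ‖(f x - g x) * v' x - (f' x - g' x) * v x‖ ≤ N * M * ‖q - q₀‖ := by
    intro v v' hv hM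
    have e1 := wronskian_sub_wronskian_one hfs hv hx
    have e2 := wronskian_eq_wronskian_one hgs hv hx
    have e : (f x - g x) * v' x - (f' x - g' x) * v x = ∫ t in x..1, f t * v t * extQ (q - q₀) t := by
      rw [← e1, h1, h1', ← e2]
      ring
    rw [e]
    refine norm_integral_mul_extQ_le (fun t ht => ?_) hx _
    rw [norm_mul]
    exact mul_le_mul (hN t ht) (hM t ht) (norm_nonneg _) hN0
  have bp := bound hp.1 hMp
  have bm := bound hms hMm
  have key : -(2 * Complex.I * k) * (f x - g x)
      = fp x * ((f x - g x) * fm' x - (f' x - g' x) * fm x)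
        - fm x * ((f x - g x) * fp' x - (f' x - g' x) * fp x) := by
    rw [← hp.wronskian_neg hm hx]
    ring
  have hb : 2 * |k| * ‖f x - g x‖ ≤ M * (N * M * ‖q - q₀‖) + M * (N * M * ‖q - q₀‖) := by
    calc 2 * |k| * ‖f x - g x‖ = ‖-(2 * Complex.I * k) * (f x - g x)‖ := by simp
      _ ≤ _ := by
        rw [key]
        refine (norm_sub_le _ _).trans ?_
        rw [norm_mul, norm_mul]
        gcongr
        · exact hMp x hx
        · exact hMm x hx
  have hk0 : 0 < |k| := abs_pos.2 hk
  rw [div_mul_eq_mul_div, div_mul_eq_mul_div, le_div_iff₀ hk0]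
  nlinarith

/-- The Jost function is Fréchet differentiable in the potential, with gradient `f₊ φ`. -/
theorem hasFDerivAt_jost {k : ℝ} (hk : k ≠ 0) {κ : ℂ} (hκ : κ ^ 2 = (k : ℂ) ^ 2) {q₀ : L2Unit}
    {fp fp' fm fm' φ φ' : ℝ → ℂ} {f f' : L2Unit → ℝ → ℂ} (hp : IsJost (extQ q₀) k fp fp')
    (hm : IsJost (extQ q₀) (-(k : ℂ)) fm fm') (hφ : IsPhi (extQ q₀) k φ φ')
    (hf : ∀ q, IsJost (extQ q) κ (f q) (f' q)) {L : L2Unit →L[ℝ] ℂ}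
    (hL : ∀ h, L h = ∫ x in (0:ℝ)..1, f q₀ x * φ x * extQ h x) :
    HasFDerivAt (fun q => f q 0) L q₀ := by
  obtain ⟨M, hMp, hMm, hM⟩ : ∃ M, (∀ x ∈ Icc (0:ℝ) 1, ‖fp x‖ ≤ M) ∧
      (∀ x ∈ Icc (0:ℝ) 1, ‖fm x‖ ≤ M) ∧ ∀ x ∈ Icc (0:ℝ) 1, ‖f q₀ x‖ ≤ M := by
    obtain ⟨A, hA⟩ := isCompact_Icc.exists_bound_of_continuousOn (hp.1.continuousOn 0 1 le_rfl)
    obtain ⟨B, hB⟩ := isCompact_Icc.exists_bound_of_continuousOn (hm.1.continuousOn 0 1 le_rfl)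
    obtain ⟨C, hC⟩ := isCompact_Icc.exists_bound_of_continuousOn
      ((hf q₀).1.continuousOn 0 1 le_rfl)
    exact ⟨max A (max B C), fun x hx => (hA x hx).trans (by simp),
      fun x hx => (hB x hx).trans (by simp), fun x hx => (hC x hx).trans (by simp)⟩
  have hM0 : 0 ≤ M := (norm_nonneg _).trans (hM 0 (by simp))
  obtain ⟨P, hP⟩ := isCompact_Icc.exists_bound_of_continuousOn (hφ.1.continuousOn 0 1 le_rfl)
  set D := M ^ 2 / |k|
  have hD0 : 0 ≤ D := by positivity
  have repr : ∀ q, f q 0 - f q₀ 0 = ∫ x in (0:ℝ)..1, f q x * φ x * extQ (q - q₀) x := by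
    intro q
    have hfs := (hf q).1
    have hgs := (hf q₀).1
    rw [hκ] at hfs hgs
    have e1 := wronskian_sub_wronskian_one hfs hφ.1 (left_mem_Icc.2 zero_le_one)
    have e2 := wronskian_eq_wronskian_one hgs hφ.1 (left_mem_Icc.2 zero_le_one)
    rw [hφ.2.1, hφ.2.2, (hf q).apply_one, (hf q).deriv_one] at e1
    rw [hφ.2.1, hφ.2.2, (hf q₀).apply_one, (hf q₀).deriv_one] at e2
    rw [← e1, ← e2]
    ring
  have close : ∀ q, D * ‖q - q₀‖ ≤ 1 / 2 → ∀ x ∈ Icc (0:ℝ) 1,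
      ‖f q x - f q₀ x‖ ≤ D * (2 * M) * ‖q - q₀‖ := by
    intro q hq
    have hc := ((hf q).1.continuousOn 0 1 le_rfl).norm
    obtain ⟨z, hz, hmax⟩ := isCompact_Icc.exists_isMaxOn (nonempty_Icc.2 zero_le_one) hc
    have hN : ∀ x ∈ Icc (0:ℝ) 1, ‖f q x‖ ≤ ‖f q z‖ := fun x hx => hmax hx
    have hd : ∀ x ∈ Icc (0:ℝ) 1, ‖f q x - f q₀ x‖ ≤ D * ‖f q z‖ * ‖q - q₀‖ := fun x hx =>
      norm_jost_sub_le hk hκ hp hm (hf q) (hf q₀) hMp hMm hN hx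
    have h2 : ‖f q z‖ ≤ 2 * M := by
      have t1 := norm_le_norm_add_norm_sub' (f q z) (f q₀ z)
      have t2 := hd z hz
      have t3 := hM z hz
      have t4 := mul_le_mul_of_nonneg_right hq (norm_nonneg (f q z))
      linarith [mul_right_comm D ‖f q z‖ ‖q - q₀‖]
    intro x hx
    refine (hd x hx).trans ?_
    gcongr
  have near : ∀ᶠ q in 𝓝 q₀, D * ‖q - q₀‖ ≤ 1 / 2 := by
    have : Tendsto (fun q : L2Unit => D * ‖q - q₀‖) (𝓝 q₀) (𝓝 (D * ‖q₀ - q₀‖)) :=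
      Continuous.tendsto (by fun_prop) q₀
    rw [sub_self, norm_zero, mul_zero] at this
    exact this.eventually_le_const (by norm_num)
  rw [hasFDerivAt_iff_isLittleO]
  refine Asymptotics.IsBigO.trans_isLittleO ?_
    (Asymptotics.isLittleO_pow_sub_sub q₀ (one_lt_two : 1 < 2))
  refine Asymptotics.IsBigO.of_bound (D * (2 * M) * P) ?_
  filter_upwards [near] with q hq
  have hcφ := hφ.1.continuousOn 0 1 le_rfl
  have e : f q 0 - f q₀ 0 - L (q - q₀)
      = ∫ x in (0:ℝ)..1, (f q x - f q₀ x) * φ x * extQ (q - q₀) x := by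
    rw [repr q, hL, ← intervalIntegral.integral_sub
      (intervalIntegrable_mul_extQ (((hf q).1.continuousOn 0 1 le_rfl).fun_mul hcφ) _)
      (intervalIntegrable_mul_extQ (((hf q₀).1.continuousOn 0 1 le_rfl).fun_mul hcφ) _)]
    congr 1
    ext x
    ring
  rw [e, norm_pow, norm_norm]
  calc _ ≤ D * (2 * M) * ‖q - q₀‖ * P * ‖q - q₀‖ := by
        refine norm_integral_mul_extQ_le (fun x hx => ?_) (left_mem_Icc.2 zero_le_one) _
        rw [norm_mul]
        exact mul_le_mul (close q hq x hx) (hP x hx) (norm_nonneg _) (by positivity)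
    _ = _ := by ring

/-- The gradients of the two Jost functions combine to a multiple of `φ`. -/
theorem jost_combination_eq {k : ℂ} {q : L2Unit} {fp fp' fm fm' φ φ' : ℝ → ℂ}
    (hp : IsJost (extQ q) k fp fp') (hm : IsJost (extQ q) (-k) fm fm')
    (hφ : IsPhi (extQ q) k φ φ') {x : ℝ} (hx : x ∈ Icc (0:ℝ) 1) :
    fm x * fp 0 - fp x * fm 0 = -(2 * Complex.I * k) * φ x := by
  have hms := hm.1
  rw [neg_sq] at hms
  have h0 : (0:ℝ) ∈ Icc (0:ℝ) 1 := left_mem_Icc.2 zero_le_one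
  have ep := (wronskian_eq_wronskian_one hp.1 hφ.1 hx).trans
    (wronskian_eq_wronskian_one hp.1 hφ.1 h0).symm
  have em := (wronskian_eq_wronskian_one hms hφ.1 hx).trans
    (wronskian_eq_wronskian_one hms hφ.1 h0).symm
  rw [hφ.2.1, hφ.2.2] at ep em
  rw [← hp.wronskian_neg hm hx]
  linear_combination fp x * em - fm x * ep

/-- For fixed real `k ≠ 0` and `q₀` with `ψ(k,q₀) ≠ 0`, the map
`q ↦ S(k,q) = ψ(-k,q)/ψ(k,q)` is Fréchet differentiable at `q₀`, with derivative
`h ↦ -2ik ∫₀¹ (φ(x,k,q₀)²/ψ(k,q₀)²) h(x) dx`. -/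
theorem statement18 (k : ℝ) (hk : k ≠ 0)
    (fp fp' fm fm' φ φ' : Lp ℝ 2 (volume.restrict (Ioo (0:ℝ) 1)) → ℝ → ℂ)
    (hfp : ∀ q, IsJost (extQ q) (k : ℂ) (fp q) (fp' q))
    (hfm : ∀ q, IsJost (extQ q) (-(k : ℂ)) (fm q) (fm' q))
    (hφ : ∀ q, IsPhi (extQ q) (k : ℂ) (φ q) (φ' q))
    (q₀ : Lp ℝ 2 (volume.restrict (Ioo (0:ℝ) 1)))
    (hψ : fp q₀ 0 ≠ 0) :
    ∃ L : Lp ℝ 2 (volume.restrict (Ioo (0:ℝ) 1)) →L[ℝ] ℂ,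
      (∀ h : Lp ℝ 2 (volume.restrict (Ioo (0:ℝ) 1)),
        L h = -(2 * Complex.I * (k : ℂ))
          * ∫ x in (0:ℝ)..1, (φ q₀ x) ^ 2 / (fp q₀ 0) ^ 2 * ((h : ℝ → ℝ) x : ℂ)) ∧
      HasFDerivAt (fun q => fm q 0 / fp q 0) L q₀ := by
  have hcφ := (hφ q₀).1.continuousOn 0 1 le_rfl
  have hcp := (hfp q₀).1.continuousOn 0 1 le_rfl
  have hcm := (hfm q₀).1.continuousOn 0 1 le_rfl
  obtain ⟨Λp, hΛp⟩ := exists_clm_integral_mul_extQ (hcp.fun_mul hcφ)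
  obtain ⟨Λm, hΛm⟩ := exists_clm_integral_mul_extQ (hcm.fun_mul hcφ)
  have dp := hasFDerivAt_jost hk rfl (hfp q₀) (hfm q₀) (hφ q₀) hfp hΛp
  have dm := hasFDerivAt_jost hk (neg_sq _) (hfp q₀) (hfm q₀) (hφ q₀) hfm hΛm
  have dS := dm.mul ((hasFDerivAt_inv' (𝕜 := ℝ) hψ).comp q₀ dp)
  refine ⟨_, fun h => ?_, dS.congr_of_eventuallyEq (Eventually.of_forall fun q => ?_)⟩
  · have e : ∫ x in (0:ℝ)..1, (φ q₀ x) ^ 2 / (fp q₀ 0) ^ 2 * ((h : ℝ → ℝ) x : ℂ)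
        = ∫ x in (0:ℝ)..1, (φ q₀ x) ^ 2 / (fp q₀ 0) ^ 2 * extQ h x := by
      refine intervalIntegral.integral_congr_ae ?_
      filter_upwards [extQ_ae_eq h] with x hx hx'
      rw [hx hx']
    have e2 : -(2 * Complex.I * (k : ℂ))
          * ∫ x in (0:ℝ)..1, (φ q₀ x) ^ 2 / (fp q₀ 0) ^ 2 * extQ h x
        = (fp q₀ 0)⁻¹ * Λm h - fm q₀ 0 * ((fp q₀ 0)⁻¹ * Λp h * (fp q₀ 0)⁻¹) := by
      have e3 : fm q₀ 0 * ((fp q₀ 0)⁻¹ * Λp h * (fp q₀ 0)⁻¹)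
          = (fm q₀ 0 * ((fp q₀ 0)⁻¹ * (fp q₀ 0)⁻¹)) * Λp h := by ring
      rw [e3, hΛm, hΛp, ← intervalIntegral.integral_const_mul,
        ← intervalIntegral.integral_const_mul, ← intervalIntegral.integral_const_mul,
        ← intervalIntegral.integral_sub
          ((intervalIntegrable_mul_extQ (hcm.fun_mul hcφ) h).const_mul _)
          ((intervalIntegrable_mul_extQ (hcp.fun_mul hcφ) h).const_mul _)]
      refine intervalIntegral.integral_congr fun x hx => ?_
      rw [uIcc_of_le zero_le_one] at hx
      have := jost_combination_eq (hfp q₀) (hfm q₀) (hφ q₀) hx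
      field_simp
      linear_combination (-φ q₀ x * extQ h x) * this
    rw [e, e2]
    simp
    ring
  · simp [div_eq_mul_inv]
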